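/- arXiv:1812.07199 — 3 statements merged into one kernel-verified Lean document; each statement's English description precedes it below -/
import Mathlib

section
/- Let n ≥ 3 and let h_{ij} denote the number of spanning trees of the complete graph K_n containing the two distinct edges i and j. Then h_{ij} = 3 n^{n−4} if i and j share exactly one vertex, and h_{ij} = 4 n^{n−4} if i and j are vertex-disjoint. -/
namespace SpanningTreeCount

open Finset SimpleGraph
open scoped Classical

variable {V : Type*}

lemma adj_of_reachable_of_adj {G T : SimpleGraph V} (hT : T.IsAcyclic) (hGT : G ≤ T) {u v : V}
    (hr : G.Reachable u v) (h : T.Adj u v) : G.Adj u v := by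
  obtain ⟨p, hp⟩ := hr.exists_isPath
  have := congrArg Walk.edges <| congrArg Subtype.val <|
    (hT.subsingleton_path u v).elim ⟨p.mapLe hGT, hp.mapLe hGT⟩ (Path.singleton h)
  exact p.adj_of_mem_edges (by simp_all)

variable [Fintype V]

/-- The labelling obtained from `c` by merging the class of `v` into the class of `u`. -/
noncomputable def merge (c : V → V) (u v w : V) : V := if c w = c v then c u else c w

/-- The number of vertices labelled `i`. -/
noncomputable def fiberCard (c : V → V) (i : V) : ℕ := #{w | c w = i}

/-- The product of the sizes of the classes of `c`. -/
noncomputable def fiberProd (c : V → V) : ℚ := ∏ i ∈ univ.image c, (fiberCard c i : ℚ)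

/-- The number of spanning trees containing `G`. -/
noncomputable def treeCount (G : SimpleGraph V) : ℕ := #{T : SimpleGraph V | T.IsTree ∧ G ≤ T}

/-- `G` is a forest and `c` labels its vertices by connected component. -/
structure IsForestLabelling (G : SimpleGraph V) (c : V → V) : Prop where
  isAcyclic : G.IsAcyclic
  label_eq_iff : ∀ u v, c u = c v ↔ G.Reachable u v
  card_edges : #G.edgeFinset + #(univ.image c) = Fintype.card V

lemma fiberCard_pos (c : V → V) (u : V) : 0 < fiberCard c (c u) :=
  card_pos.2 ⟨u, by simp⟩

section Merge

variable {c : V → V} {u v : V}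

lemma image_merge (h : c u ≠ c v) : univ.image (merge c u v) = (univ.image c).erase (c v) := by
  ext i
  simp only [mem_image, mem_univ, true_and, mem_erase, merge]
  constructor
  · rintro ⟨w, rfl⟩
    split_ifs with hw
    · exact ⟨h, u, rfl⟩
    · exact ⟨hw, w, rfl⟩
  · rintro ⟨hi, w, rfl⟩
    exact ⟨w, if_neg hi⟩

lemma card_image_merge (h : c u ≠ c v) :
    #(univ.image (merge c u v)) + 1 = #(univ.image c) := by
  rw [image_merge h]
  exact card_erase_add_one (by simp)

lemma fiberCard_merge_self (h : c u ≠ c v) :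
    fiberCard (merge c u v) (c u) = fiberCard c (c u) + fiberCard c (c v) := by
  unfold fiberCard
  rw [← card_union_of_disjoint]
  · congr 1
    ext w
    rw [mem_union, mem_filter_univ, mem_filter_univ, mem_filter_univ, merge]
    split_ifs with hw <;> grind
  · rw [Finset.disjoint_left]
    intro w
    simp only [mem_filter, mem_univ, true_and]
    grind

lemma fiberCard_merge_of_ne {i : V} (hu : i ≠ c u) (hv : i ≠ c v) :
    fiberCard (merge c u v) i = fiberCard c i := by
  unfold fiberCard
  congr 1
  ext w
  rw [mem_filter_univ, mem_filter_univ, merge]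
  split_ifs with hw <;> grind

lemma fiberProd_merge_mul (h : c u ≠ c v) :
    fiberProd (merge c u v) * (fiberCard c (c u) * fiberCard c (c v)) =
      fiberProd c * (fiberCard c (c u) + fiberCard c (c v)) := by
  have hv : c v ∈ univ.image c := by simp
  have hu : c u ∈ (univ.image c).erase (c v) := by simp [h]
  have hrest : ∏ i ∈ ((univ.image c).erase (c v)).erase (c u), (fiberCard (merge c u v) i : ℚ) =
      ∏ i ∈ ((univ.image c).erase (c v)).erase (c u), (fiberCard c i : ℚ) :=
    prod_congr rfl fun i hi => by
      rw [fiberCard_merge_of_ne (ne_of_mem_erase hi) (ne_of_mem_erase (mem_of_mem_erase hi))]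
  unfold fiberProd
  rw [image_merge h, ← mul_prod_erase _ _ hu, ← mul_prod_erase (univ.image c) _ hv,
    ← mul_prod_erase ((univ.image c).erase (c v)) (fun i => (fiberCard c i : ℚ)) hu, hrest,
    fiberCard_merge_self h]
  push_cast
  ring

end Merge

lemma sum_inv_fiberCard (c : V → V) :
    ∑ u, (fiberCard c (c u) : ℚ)⁻¹ = #(univ.image c) := by
  rw [sum_comp (fun i => (fiberCard c i : ℚ)⁻¹) c, card_eq_sum_ones, Nat.cast_sum]
  refine sum_congr rfl fun i hi => ?_
  obtain ⟨u, -, rfl⟩ := mem_image.1 hi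
  have := fiberCard_pos c u
  rw [nsmul_eq_mul]
  change (fiberCard c (c u) : ℚ) * _ = _
  rw [mul_inv_cancel₀ (by positivity), Nat.cast_one]

lemma card_label_ne (c : V → V) (u : V) :
    (#{v | c u ≠ c v} : ℚ) = Fintype.card V - fiberCard c (c u) := by
  have h := card_filter_add_card_filter_not (s := (univ : Finset V)) (fun v => c v = c u)
  rw [card_univ] at h
  unfold fiberCard
  rw [← h]
  push_cast
  simp [eq_comm]

lemma sum_pairs_inv_fiberCard (c : V → V) :
    ∑ p : V × V with c p.1 ≠ c p.2,
      ((fiberCard c (c p.1) : ℚ)⁻¹ + (fiberCard c (c p.2) : ℚ)⁻¹) =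
      2 * (Fintype.card V * (#(univ.image c) - 1)) := by
  have hfst : ∑ p : V × V with c p.1 ≠ c p.2, (fiberCard c (c p.1) : ℚ)⁻¹ =
      Fintype.card V * (#(univ.image c) - 1) := by
    rw [sum_filter, ← univ_product_univ, sum_product]
    have (u : V) : ∑ v, (if c u ≠ c v then (fiberCard c (c u) : ℚ)⁻¹ else 0) =
        Fintype.card V * (fiberCard c (c u) : ℚ)⁻¹ - 1 := by
      have := fiberCard_pos c u
      rw [← sum_filter, sum_const, nsmul_eq_mul, card_label_ne, sub_mul,
        mul_inv_cancel₀ (by positivity)]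
    simp only [this]
    rw [sum_sub_distrib, ← mul_sum, sum_inv_fiberCard]
    simp
    ring
  have hsnd : ∑ p : V × V with c p.1 ≠ c p.2, (fiberCard c (c p.2) : ℚ)⁻¹ =
      ∑ p : V × V with c p.1 ≠ c p.2, (fiberCard c (c p.1) : ℚ)⁻¹ :=
    sum_equiv (Equiv.prodComm V V) (by simp [eq_comm]) (by simp)
  rw [sum_add_distrib, hsnd, hfst]
  ring

lemma isForestLabelling_bot : IsForestLabelling (⊥ : SimpleGraph V) id where
  isAcyclic := isAcyclic_bot
  label_eq_iff := by simp
  card_edges := by simp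

namespace IsForestLabelling

variable {G : SimpleGraph V} {c : V → V}

lemma sup_edge (hG : IsForestLabelling G c) {u v : V} (h : c u ≠ c v) :
    IsForestLabelling (G ⊔ edge u v) (merge c u v) where
  isAcyclic := hG.isAcyclic.sup_edge_of_not_reachable (mt (hG.label_eq_iff u v).2 h)
  label_eq_iff := by
    have hne : u ≠ v := fun e => h (e ▸ rfl)
    have huv : (G ⊔ edge u v).Reachable u v :=
      Adj.reachable (Or.inr (by simp [edge_adj, hne]))
    have lift {x y : V} (hxy : c x = c y) : (G ⊔ edge u v).Reachable x y :=
      ((hG.label_eq_iff x y).1 hxy).mono le_sup_left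
    have hrep (w : V) : ∃ x, c x = merge c u v w ∧ (G ⊔ edge u v).Reachable w x := by
      unfold merge
      split_ifs with hw
      · exact ⟨u, rfl, (lift hw).trans huv.symm⟩
      · exact ⟨w, rfl, Reachable.refl _⟩
    intro x y
    constructor
    · intro hxy
      obtain ⟨x', hx', hxx'⟩ := hrep x
      obtain ⟨y', hy', hyy'⟩ := hrep y
      exact (hxx'.trans (lift (by rw [hx', hy', hxy]))).trans hyy'.symm
    · rintro ⟨p⟩
      induction p with
      | nil => rfl
      | cons hadj _ ih =>
        rw [← ih]
        rcases hadj with hadj | hadj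
        · unfold merge
          rw [(hG.label_eq_iff _ _).2 hadj.reachable]
        · rw [edge_adj] at hadj
          unfold merge
          grind
  card_edges := by
    have hne : u ≠ v := fun e => h (e ▸ rfl)
    have hadj : ¬ G.Adj u v := fun e => h ((hG.label_eq_iff u v).2 e.reachable)
    have h1 := G.card_edgeFinset_sup_edge hadj hne
    have h2 := card_image_merge h
    have h3 := hG.card_edges
    refine (congrArg (· + _) (?_ : _ = #G.edgeFinset + 1)).trans ?_
    · convert h1
    · omega

lemma card_crossing (hG : IsForestLabelling G c) {T : SimpleGraph V} (hT : T.IsTree)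
    (hGT : G ≤ T) :
    #{p : V × V | c p.1 ≠ c p.2 ∧ G ⊔ edge p.1 p.2 ≤ T} = 2 * (#(univ.image c) - 1) := by
  have hset : ({p : V × V | c p.1 ≠ c p.2 ∧ G ⊔ edge p.1 p.2 ≤ T} : Finset (V × V)) =
      ({p : V × V | T.Adj p.1 p.2} : Finset (V × V)) \
        ({p : V × V | G.Adj p.1 p.2} : Finset (V × V)) := by
    ext ⟨u, v⟩
    simp only [mem_filter, mem_univ, true_and, mem_sdiff, sup_le_iff]
    constructor
    · rintro ⟨h, -, he⟩
      have hne : u ≠ v := fun e => h (e ▸ rfl)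
      exact ⟨he (by simp [edge_adj, hne]), fun e => h ((hG.label_eq_iff u v).2 e.reachable)⟩
    · rintro ⟨h, hn⟩
      refine ⟨fun e => hn (adj_of_reachable_of_adj hT.isAcyclic hGT
        ((hG.label_eq_iff u v).1 e) h), hGT, ?_⟩
      rw [edge_le_iff]
      exact Or.inr h
  have hsub : ({p : V × V | G.Adj p.1 p.2} : Finset (V × V)) ⊆
      ({p : V × V | T.Adj p.1 p.2} : Finset (V × V)) := by
    intro p
    simpa using fun h => hGT h
  rw [hset, card_sdiff_of_subset hsub]
  have h1 : 2 * #G.edgeFinset = #{p : V × V | G.Adj p.1 p.2} := G.two_mul_card_edgeFinset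
  have h2 : 2 * #T.edgeFinset = #{p : V × V | T.Adj p.1 p.2} := T.two_mul_card_edgeFinset
  have h3 := hT.card_edgeFinset
  have h4 := hG.card_edges
  omega

/-- Double counting of pairs (spanning tree above `G`, oriented edge of it joining two
components of `G`). -/
lemma sum_treeCount_sup_edge (hG : IsForestLabelling G c) :
    ∑ p : V × V with c p.1 ≠ c p.2, treeCount (G ⊔ edge p.1 p.2) =
      treeCount G * (2 * (#(univ.image c) - 1)) := by
  have h := sum_card_bipartiteAbove_eq_sum_card_bipartiteBelow
    (s := ({p : V × V | c p.1 ≠ c p.2} : Finset (V × V)))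
    (t := ({T : SimpleGraph V | T.IsTree ∧ G ≤ T} : Finset (SimpleGraph V)))
    (fun p T => G ⊔ edge p.1 p.2 ≤ T)
  unfold treeCount
  rw [← smul_eq_mul, ← sum_const]
  convert h using 2 with p _ T hT
  · unfold bipartiteAbove
    rw [filter_filter]
    congr 1
    ext T
    simp only [mem_filter, mem_univ, true_and, sup_le_iff]
    tauto
  · rw [mem_filter_univ] at hT
    rw [← hG.card_crossing hT.1 hT.2]
    unfold bipartiteBelow
    rw [filter_filter]

/-- The number of spanning trees containing a given forest. -/
theorem treeCount_mul [Nonempty V] (hG : IsForestLabelling G c) :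
    (treeCount G : ℚ) * Fintype.card V ^ 2 =
      Fintype.card V ^ #(univ.image c) * fiberProd c := by
  induction hk : #(univ.image c) generalizing G c with
  | zero => simp [univ_eq_empty_iff] at hk
  | succ k ih =>
    rcases Nat.eq_zero_or_pos k with rfl | hpos
    · obtain ⟨i, hi⟩ := card_eq_one.1 hk
      have hc (u : V) : c u = i := by
        have : c u ∈ univ.image c := by simp
        simpa [hi] using this
      have hreach (u v : V) : G.Reachable u v := (hG.label_eq_iff u v).1 (by rw [hc, hc])
      have hcount : treeCount G = 1 := by
        refine card_eq_one.2 ⟨G, ?_⟩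
        ext T
        simp only [mem_filter, mem_univ, true_and, mem_singleton]
        constructor
        · rintro ⟨hT, hGT⟩
          exact le_antisymm
            (fun u v h => adj_of_reachable_of_adj hT.isAcyclic hGT (hreach u v) h) hGT
        · rintro rfl
          exact ⟨⟨⟨hreach⟩, hG.isAcyclic⟩, le_rfl⟩
      have hfib : fiberCard c i = Fintype.card V := by simp [fiberCard, hc]
      rw [hcount, fiberProd, hi, prod_singleton, hfib]
      simp
      ring
    · have key := congrArg (fun m : ℕ => (m : ℚ) * Fintype.card V ^ 2) hG.sum_treeCount_sup_edge
      have hstep : ∀ p ∈ ({p : V × V | c p.1 ≠ c p.2} : Finset (V × V)),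
          (treeCount (G ⊔ edge p.1 p.2) : ℚ) * Fintype.card V ^ 2 =
          Fintype.card V ^ k * fiberProd c *
            ((fiberCard c (c p.1) : ℚ)⁻¹ + (fiberCard c (c p.2) : ℚ)⁻¹) := by
        intro p hp
        have hne : c p.1 ≠ c p.2 := by simpa using hp
        rw [ih (hG.sup_edge hne) (by have := card_image_merge hne; omega), mul_assoc]
        congr 1
        have h1 := fiberCard_pos c p.1
        have h2 := fiberCard_pos c p.2
        have := fiberProd_merge_mul hne
        field_simp
        linear_combination this
      simp only [Nat.cast_sum, Nat.cast_mul, sum_mul] at key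
      rw [sum_congr rfl hstep, ← mul_sum, sum_pairs_inv_fiberCard, hk] at key
      have hk0 : (k : ℚ) ≠ 0 := by positivity
      push_cast [Nat.add_sub_cancel] at key
      refine mul_left_cancel₀ (mul_ne_zero two_ne_zero hk0) ?_
      rw [pow_succ (Fintype.card V : ℚ) k]
      linear_combination -key

end IsForestLabelling

lemma fiberCard_id (i : V) : fiberCard id i = 1 := by
  exact card_eq_one.2 ⟨i, by ext; simp⟩

lemma fiberProd_id : fiberProd (id : V → V) = 1 := by
  simp [fiberProd, fiberCard_id]

lemma fiberProd_merge_id {a b : V} (hab : a ≠ b) : fiberProd (merge id a b) = 2 := by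
  have h := fiberProd_merge_mul (c := id) (u := a) (v := b) hab
  norm_num [fiberCard_id, fiberProd_id] at h
  exact h

lemma treeCount_two_edges {a b x y : V} (hab : a ≠ b)
    (hxy : merge id a b x ≠ merge id a b y) :
    (treeCount (edge a b ⊔ edge x y) : ℚ) =
      fiberProd (merge (merge id a b) x y) *
        (Fintype.card V : ℚ) ^ ((Fintype.card V : ℤ) - 4) := by
  have : Nonempty V := ⟨a⟩
  have hab' : id a ≠ id b := hab
  have h := ((isForestLabelling_bot.sup_edge hab').sup_edge hxy).treeCount_mul
  have h1 := card_image_merge hab'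
  have h2 := card_image_merge hxy
  rw [image_id, card_univ] at h1
  rw [bot_sup_eq] at h
  have h3 : ((Fintype.card V : ℤ) - 4) =
      (#(univ.image (merge (merge id a b) x y)) : ℤ) - (2 : ℕ) := by
    push_cast
    omega
  have hn0 : (Fintype.card V : ℚ) ≠ 0 := by positivity
  rw [h3, zpow_sub₀ hn0, zpow_natCast, zpow_natCast, ← mul_div_assoc,
    eq_div_iff (pow_ne_zero 2 hn0), h, mul_comm]

theorem treeCount_adjacent_edges {a b y : V} (hab : a ≠ b)
    (hay : a ≠ y) (hby : b ≠ y) :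
    (treeCount (edge a b ⊔ edge a y) : ℚ) =
      3 * (Fintype.card V : ℚ) ^ ((Fintype.card V : ℤ) - 4) := by
  have ha : merge id a b a = a := if_neg hab
  have hy : merge id a b y = y := if_neg hby.symm
  have hne : merge id a b a ≠ merge id a b y := by rwa [ha, hy]
  have h := fiberProd_merge_mul hne
  have hfa : fiberCard (merge id a b) a = 2 := by
    have := fiberCard_merge_self (c := id) (u := a) (v := b) hab
    simpa [fiberCard_id] using this
  have hfy : fiberCard (merge id a b) y = 1 :=
    (fiberCard_merge_of_ne (c := id) hay.symm hby.symm).trans (fiberCard_id y)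
  rw [ha, hy, hfa, hfy, fiberProd_merge_id hab] at h
  rw [treeCount_two_edges hab hne]
  congr 1
  push_cast at h
  linarith

theorem treeCount_disjoint_edges {a b x y : V} (hab : a ≠ b)
    (hxy : x ≠ y) (hax : a ≠ x) (hay : a ≠ y) (hbx : b ≠ x) (hby : b ≠ y) :
    (treeCount (edge a b ⊔ edge x y) : ℚ) =
      4 * (Fintype.card V : ℚ) ^ ((Fintype.card V : ℤ) - 4) := by
  have hx : merge id a b x = x := if_neg hbx.symm
  have hy : merge id a b y = y := if_neg hby.symm
  have hne : merge id a b x ≠ merge id a b y := by rwa [hx, hy]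
  have h := fiberProd_merge_mul hne
  have hfx : fiberCard (merge id a b) x = 1 :=
    (fiberCard_merge_of_ne (c := id) hax.symm hbx.symm).trans (fiberCard_id x)
  have hfy : fiberCard (merge id a b) y = 1 :=
    (fiberCard_merge_of_ne (c := id) hay.symm hby.symm).trans (fiberCard_id y)
  rw [hx, hy, hfx, hfy, fiberProd_merge_id hab] at h
  rw [treeCount_two_edges hab hne]
  congr 1
  push_cast at h
  linarith

lemma ncard_trees_eq_treeCount {a b x y : V} (hab : a ≠ b) (hxy : x ≠ y) :
    {T : SimpleGraph V | T.IsTree ∧ s(a, b) ∈ T.edgeSet ∧ s(x, y) ∈ T.edgeSet}.ncard =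
      treeCount (edge a b ⊔ edge x y) := by
  rw [treeCount, ← Set.ncard_coe_finset]
  congr 1
  ext T
  simp [hab, hxy]

end SpanningTreeCount

/-- For `n ≥ 3` and distinct edges `e, f` of `K_n`, the number of spanning trees of
`K_n` containing both is `3 n^(n-4)` if `e` and `f` share a vertex, and `4 n^(n-4)`
if they are vertex-disjoint. -/
theorem stmt_6 (n : ℕ) (hn : 3 ≤ n) (e f : Sym2 (Fin n))
    (he : ¬ e.IsDiag) (hf : ¬ f.IsDiag) (hef : e ≠ f) :
    ((∃ v, v ∈ e ∧ v ∈ f) →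
      ({T : SimpleGraph (Fin n) | T.IsTree ∧ e ∈ T.edgeSet ∧ f ∈ T.edgeSet}.ncard : ℚ)
        = 3 * (n : ℚ) ^ ((n : ℤ) - 4)) ∧
    ((¬ ∃ v, v ∈ e ∧ v ∈ f) →
      ({T : SimpleGraph (Fin n) | T.IsTree ∧ e ∈ T.edgeSet ∧ f ∈ T.edgeSet}.ncard : ℚ)
        = 4 * (n : ℚ) ^ ((n : ℤ) - 4)) := by
  induction e with | _ a b
  induction f with | _ x y
  rw [Sym2.mk_isDiag_iff] at he hf
  rw [SpanningTreeCount.ncard_trees_eq_treeCount he hf]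
  have adj {a b y : Fin n} :=
    SpanningTreeCount.treeCount_adjacent_edges (a := a) (b := b) (y := y)
  have disj := SpanningTreeCount.treeCount_disjoint_edges he hf
  rw [Fintype.card_fin] at adj disj
  constructor
  · rintro ⟨v, hv, hv'⟩
    rw [Sym2.mem_iff] at hv hv'
    rcases hv with rfl | rfl <;> rcases hv' with rfl | rfl
    · exact adj he hf fun h => hef (h ▸ rfl)
    · rw [SimpleGraph.edge_comm x v]
      exact adj he (Ne.symm hf) fun h => hef (h ▸ Sym2.eq_swap)
    · rw [SimpleGraph.edge_comm a v]
      exact adj (Ne.symm he) hf fun h => hef (h ▸ Sym2.eq_swap)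
    · rw [SimpleGraph.edge_comm a v, SimpleGraph.edge_comm x v]
      exact adj (Ne.symm he) (Ne.symm hf) fun h => hef (h ▸ rfl)
  · intro h
    have hdisj (v : Fin n) (hv : v = a ∨ v = b) (hv' : v = x ∨ v = y) : False :=
      h ⟨v, Sym2.mem_iff.2 hv, Sym2.mem_iff.2 hv'⟩
    exact disj (fun h => hdisj a (.inl rfl) (.inl h)) (fun h => hdisj a (.inl rfl) (.inr h))
      (fun h => hdisj b (.inr rfl) (.inl h)) (fun h => hdisj b (.inr rfl) (.inr h))
end

section
/- Let n ≥ 3 and let H̃ be the matrix indexed by the edges of K_n whose (i,j) entry is the number of spanning trees of K_n containing both edges i and j (so diagonal entries are 0, entries 3n^{n−4} for edges sharing a vertex, 4n^{n−4} for disjoint edges). Then the eigenvalues of H̃ are −2n^{n−4}, −n^{n−3}, and 2(n−2)n^{n−3}, with multiplicities C(n,2)−n, n−1, and 1, respectively. -/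
namespace SimpleGraph

variable {V : Type*}

theorem reachable_sup_edge_iff {G : SimpleGraph V} {u v x y : V} :
    (G ⊔ edge u v).Reachable x y ↔ G.Reachable x y ∨
      (G.Reachable x u ∧ G.Reachable v y) ∨ (G.Reachable x v ∧ G.Reachable u y) := by
  constructor
  · rintro ⟨p⟩
    induction p with
    | nil => exact .inl .rfl
    | @cons a b c hab _ ih =>
      rw [sup_adj, edge_adj] at hab
      rcases hab with hab | ⟨⟨rfl, rfl⟩ | ⟨rfl, rfl⟩, -⟩
      · have := hab.reachable
        rcases ih with h | ⟨h, h'⟩ | ⟨h, h'⟩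
        · exact .inl (this.trans h)
        · exact .inr (.inl ⟨this.trans h, h'⟩)
        · exact .inr (.inr ⟨this.trans h, h'⟩)
      · rcases ih with h | ⟨h, h'⟩ | ⟨h, h'⟩
        · exact .inr (.inl ⟨.rfl, h⟩)
        · exact .inr (.inl ⟨.rfl, h'⟩)
        · exact .inl h'
      · rcases ih with h | ⟨h, h'⟩ | ⟨h, h'⟩
        · exact .inr (.inr ⟨.rfl, h⟩)
        · exact .inl h'
        · exact .inr (.inr ⟨.rfl, h'⟩)
  · have mono {a b : V} (h : G.Reachable a b) : (G ⊔ edge u v).Reachable a b :=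
      h.mono le_sup_left
    have huv : (G ⊔ edge u v).Reachable u v := by
      rcases eq_or_ne u v with rfl | hne
      · rfl
      · exact Adj.reachable (.inr (by simp [edge_adj, hne]))
    rintro (h | ⟨h, h'⟩ | ⟨h, h'⟩)
    · exact mono h
    · exact (mono h).trans (huv.trans (mono h'))
    · exact (mono h).trans (huv.symm.trans (mono h'))

variable [Fintype V]

open Classical in
/-- The set of vertices in the connected component of `u`. -/
noncomputable def component (G : SimpleGraph V) (u : V) : Finset V :=
  Finset.univ.filter (G.Reachable u)

@[simp] theorem mem_component {G : SimpleGraph V} {u v : V} :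
    v ∈ G.component u ↔ G.Reachable u v := by simp [component]

theorem component_congr {G : SimpleGraph V} {u v : V} (h : G.Reachable u v) :
    G.component u = G.component v := by
  ext x
  simpa using ⟨h.symm.trans, h.trans⟩

theorem card_component_pos (G : SimpleGraph V) (u : V) : 0 < (G.component u).card :=
  Finset.card_pos.mpr ⟨u, by simp⟩

/-- The sum of `g |C|` over all connected components `C`, written as a sum over vertices. -/
noncomputable def componentSum (G : SimpleGraph V) (g : ℕ → ℝ) : ℝ :=
  ∑ u, g (G.component u).card / (G.component u).card

theorem disjoint_component {G : SimpleGraph V} {u v : V} (h : ¬ G.Reachable u v) :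
    Disjoint (G.component u) (G.component v) := by
  rw [Finset.disjoint_left]
  intro x hx hx'
  rw [mem_component] at hx hx'
  exact h (hx.trans hx'.symm)

theorem sum_component_div (G : SimpleGraph V) (g : ℕ → ℝ) (u : V) :
    ∑ x ∈ G.component u, g (G.component x).card / (G.component x).card =
      g (G.component u).card := by
  have h : ∀ x ∈ G.component u, g (G.component x).card / (G.component x).card =
      g (G.component u).card / (G.component u).card := fun x hx ↦ by
    rw [component_congr (mem_component.mp hx)]
  have := G.card_component_pos u
  rw [Finset.sum_congr rfl h, Finset.sum_const, nsmul_eq_mul]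
  field_simp

theorem component_sup_edge_left [DecidableEq V] (G : SimpleGraph V) (u v : V) :
    (G ⊔ edge u v).component u = G.component u ∪ G.component v := by
  ext x
  simp only [mem_component, reachable_sup_edge_iff, Finset.mem_union]
  grind [Reachable.refl]

theorem component_sup_edge_of_notMem {G : SimpleGraph V} {u v x : V}
    (hu : ¬ G.Reachable u x) (hv : ¬ G.Reachable v x) :
    (G ⊔ edge u v).component x = G.component x := by
  ext y
  simp only [mem_component, reachable_sup_edge_iff]
  grind [Reachable.symm]

theorem componentSum_sup_edge {G : SimpleGraph V} {u v : V} (h : ¬ G.Reachable u v)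
    (g : ℕ → ℝ) :
    (G ⊔ edge u v).componentSum g = G.componentSum g - g (G.component u).card
      - g (G.component v).card + g ((G.component u).card + (G.component v).card) := by
  classical
  have hd := disjoint_component h
  have hG := Finset.sum_add_sum_compl (G.component u ∪ G.component v)
    fun x ↦ g (G.component x).card / (G.component x).card
  have hG' := Finset.sum_add_sum_compl (G.component u ∪ G.component v)
    fun x ↦ g ((G ⊔ edge u v).component x).card / ((G ⊔ edge u v).component x).card
  rw [Finset.sum_union hd, sum_component_div, sum_component_div] at hG
  rw [← component_sup_edge_left, sum_component_div, component_sup_edge_left,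
    Finset.card_union_of_disjoint hd] at hG'
  rw [componentSum, componentSum, ← hG, ← hG']
  have : ∀ x ∈ (G.component u ∪ G.component v)ᶜ,
      g ((G ⊔ edge u v).component x).card / ((G ⊔ edge u v).component x).card =
      g (G.component x).card / (G.component x).card := fun x hx ↦ by
    simp only [Finset.mem_compl, Finset.mem_union, mem_component, not_or] at hx
    rw [component_sup_edge_of_notMem hx.1 hx.2]
  rw [Finset.sum_congr rfl this]
  ring

theorem component_bot (u : V) : (⊥ : SimpleGraph V).component u = {u} := by
  ext x
  simp [eq_comm]

theorem componentSum_bot (g : ℕ → ℝ) :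
    (⊥ : SimpleGraph V).componentSum g = Fintype.card V * g 1 := by
  simp [componentSum, component_bot]

/-- The product of the cardinalities of the connected components. -/
noncomputable def componentProd (G : SimpleGraph V) : ℝ :=
  Real.exp (G.componentSum fun k ↦ Real.log k)

theorem componentProd_bot : (⊥ : SimpleGraph V).componentProd = 1 := by
  simp [componentProd, componentSum_bot]

theorem componentProd_sup_edge {G : SimpleGraph V} {u v : V} (h : ¬ G.Reachable u v) :
    (G ⊔ edge u v).componentProd = G.componentProd *
      (1 / (G.component u).card + 1 / (G.component v).card) := by
  have hu : (0 : ℝ) < (G.component u).card := mod_cast G.card_component_pos u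
  have hv : (0 : ℝ) < (G.component v).card := mod_cast G.card_component_pos v
  rw [componentProd, componentSum_sup_edge h, Real.exp_add, Real.exp_sub, Real.exp_sub,
    Real.exp_log hu, Real.exp_log hv, Real.exp_log (by push_cast; positivity), componentProd]
  push_cast
  field_simp
  ring

theorem sum_not_reachable (G : SimpleGraph V) [DecidableRel G.Reachable] :
    ∑ p : V × V with ¬ G.Reachable p.1 p.2,
      (1 / (G.component p.1).card + 1 / (G.component p.2).card : ℝ) =
      2 * Fintype.card V * (G.componentSum (fun _ ↦ 1) - 1) := by
  have key : ∑ p : V × V with ¬ G.Reachable p.1 p.2, (1 / (G.component p.1).card : ℝ) =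
      Fintype.card V * (G.componentSum (fun _ ↦ 1) - 1) := by
    rw [Finset.sum_filter, Fintype.sum_prod_type, componentSum, mul_sub, Finset.mul_sum, mul_one,
      ← Finset.card_univ, Finset.cast_card, ← Finset.sum_sub_distrib]
    refine Finset.sum_congr rfl fun u _ ↦ ?_
    have hu : (0 : ℝ) < (G.component u).card := mod_cast G.card_component_pos u
    rw [← Finset.sum_filter, Finset.sum_const, nsmul_eq_mul]
    have := Finset.card_filter_add_card_filter_not (s := Finset.univ) (G.Reachable u)
    have h2 : Finset.univ.filter (G.Reachable u) = G.component u := by ext; simp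
    rw [h2] at this
    rw [← this]
    dsimp only
    rw [Finset.sum_const, nsmul_eq_mul]
    push_cast
    field_simp
    ring
  rw [Finset.sum_add_distrib, key]
  have : ∑ p : V × V with ¬ G.Reachable p.1 p.2, (1 / (G.component p.2).card : ℝ) =
      ∑ p : V × V with ¬ G.Reachable p.1 p.2, (1 / (G.component p.1).card : ℝ) := by
    refine Finset.sum_equiv (Equiv.prodComm V V) ?_ ?_
    · simp [reachable_comm]
    · simp
  rw [this, key]
  ring

omit [Fintype V] in
theorem IsAcyclic.not_reachable_of_adj {F T : SimpleGraph V} (hT : T.IsAcyclic) (hFT : F ≤ T)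
    {u v : V} (h : T.Adj u v) (hF : ¬ F.Adj u v) : ¬ F.Reachable u v := by
  have hb := isAcyclic_iff_forall_adj_isBridge.mp hT h
  rw [isBridge_iff] at hb
  refine fun hr ↦ hb (hr.mono fun a b hab ↦ ?_)
  rw [deleteEdges_adj]
  refine ⟨hFT hab, fun he ↦ hF ?_⟩
  rw [Set.mem_singleton_iff] at he
  rwa [← mem_edgeSet, ← he]

open Classical in
theorem card_adj_pairs (G : SimpleGraph V) :
    (Finset.univ.filter fun p : V × V ↦ G.Adj p.1 p.2).card = 2 * G.edgeFinset.card := by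
  rw [← sum_degrees_eq_twice_card_edges, Finset.card_filter, Fintype.sum_prod_type]
  refine Finset.sum_congr rfl fun u _ ↦ ?_
  rw [← Finset.card_filter, ← card_neighborFinset_eq_degree]
  congr 1
  ext
  simp

theorem ncard_edgeSet_sup_edge (G : SimpleGraph V) {u v : V} (h : ¬ G.Adj u v) (huv : u ≠ v) :
    (G ⊔ edge u v).edgeSet.ncard = G.edgeSet.ncard + 1 := by
  rw [edgeSet_sup, edgeSet_edge_of_ne huv, Set.union_singleton,
    Set.ncard_insert_of_notMem (by simpa using h)]

open Classical in
/-- Double counting of the pairs `(T, (u, v))` with `T` a spanning tree containing `F` and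
`u v` an edge of `T` which is not in `F`. -/
theorem sum_card_isTree_sup_edge (F : SimpleGraph V) :
    ∑ p : V × V with ¬ F.Reachable p.1 p.2,
      (Finset.univ.filter fun T : SimpleGraph V ↦ T.IsTree ∧ F ⊔ edge p.1 p.2 ≤ T).card =
      2 * (Fintype.card V - 1 - F.edgeSet.ncard) *
        (Finset.univ.filter fun T : SimpleGraph V ↦ T.IsTree ∧ F ≤ T).card := by
  simp_rw [Finset.card_filter]
  rw [Finset.sum_comm, Finset.mul_sum]
  refine Finset.sum_congr rfl fun T _ ↦ ?_
  by_cases hT : T.IsTree ∧ F ≤ T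
  · have hset : (Finset.univ.filter fun p : V × V ↦ ¬ F.Reachable p.1 p.2).filter
        (fun p ↦ T.IsTree ∧ F ⊔ edge p.1 p.2 ≤ T) =
        (Finset.univ.filter fun p : V × V ↦ T.Adj p.1 p.2) \
          (Finset.univ.filter fun p : V × V ↦ F.Adj p.1 p.2) := by
      ext ⟨u, v⟩
      simp only [Finset.mem_filter, Finset.mem_univ, true_and, Finset.mem_sdiff, hT.1,
        sup_le_iff, hT.2, edge_le_iff]
      constructor
      · rintro ⟨hr, rfl | h⟩
        · exact absurd .rfl hr
        · exact ⟨h, fun h ↦ hr h.reachable⟩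
      · rintro ⟨h, h'⟩
        exact ⟨hT.1.isAcyclic.not_reachable_of_adj hT.2 h h', .inr h⟩
    rw [← Finset.card_filter, hset, Finset.card_sdiff_of_subset, card_adj_pairs, card_adj_pairs,
      if_pos hT, mul_one, ← hT.1.card_edgeFinset, ← coe_edgeFinset, Set.ncard_coe_finset]
    · grind
    · intro p
      simpa using @hT.2 p.1 p.2
  · rw [if_neg hT, mul_zero]
    refine Finset.sum_eq_zero fun p _ ↦ if_neg fun h ↦ hT ⟨h.1, le_sup_left.trans h.2⟩

theorem isTree_of_componentSum_eq_one {F : SimpleGraph V} (hF : F.IsAcyclic)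
    (h : F.componentSum (fun _ ↦ 1) = 1) : F.IsTree := by
  classical
  have hne : Nonempty V := by
    by_contra hV
    rw [not_nonempty_iff] at hV
    simp [componentSum] at h
  refine ⟨⟨fun u v ↦ ?_⟩, hF⟩
  by_contra huv
  have hpos := sum_not_reachable F
  rw [h, sub_self, mul_zero, Finset.sum_eq_zero_iff_of_nonneg (fun _ _ ↦ by positivity)] at hpos
  have hu : (0 : ℝ) < (F.component u).card := mod_cast F.card_component_pos u
  have := hpos (u, v) (by simpa using huv)
  dsimp only at this
  have : (0 : ℝ) < 1 / (F.component u).card + 1 / (F.component v).card := by positivity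
  linarith

open Classical in
/-- The number of spanning trees of a complete graph on `n` vertices which contain a given forest
with `m + 1` components is `n ^ (m - 1)` times the product of the cardinalities of its
components. -/
theorem IsAcyclic.card_isTree_ge {F : SimpleGraph V} (hF : F.IsAcyclic) {m : ℕ}
    (hm : F.edgeSet.ncard + m + 1 = Fintype.card V)
    (hk : F.componentSum (fun _ ↦ 1) = m + 1) :
    ((Finset.univ.filter fun T : SimpleGraph V ↦ T.IsTree ∧ F ≤ T).card : ℝ) *
      Fintype.card V ^ 2 = Fintype.card V ^ (m + 1) * F.componentProd := by
  induction m generalizing F with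
  | zero =>
    have hT := isTree_of_componentSum_eq_one hF (by simpa using hk)
    have hset : (Finset.univ.filter fun T : SimpleGraph V ↦ T.IsTree ∧ F ≤ T) = {F} := by
      ext T
      simp only [Finset.mem_filter, Finset.mem_univ, true_and, Finset.mem_singleton]
      refine ⟨fun ⟨h, h'⟩ ↦ ?_, ?_⟩
      swap
      · rintro rfl
        exact ⟨hT, le_rfl⟩
      exact le_antisymm ((isTree_iff_maximal_isAcyclic.mp hT).2.le_of_ge h.isAcyclic h') h'
    have hc : ∀ u, F.component u = Finset.univ := fun u ↦ by
      ext x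
      simpa using hT.connected.preconnected u x
    have hn : (0 : ℝ) < Fintype.card V := by
      rw [← hm]
      positivity
    rw [hset, componentProd, componentSum]
    simp only [hc, Finset.card_univ, Finset.sum_const, nsmul_eq_mul, Finset.card_singleton]
    rw [mul_div_cancel₀ _ hn.ne', Real.exp_log hn]
    push_cast
    ring
  | succ m ih =>
    have hn : (0 : ℝ) < Fintype.card V := by
      rw [← hm]
      positivity
    have hsum := sum_card_isTree_sup_edge F
    have hsub : Fintype.card V - 1 - F.edgeSet.ncard = m + 1 := by omega
    rw [hsub] at hsum
    have hstep : ∀ p ∈ (Finset.univ.filter fun p : V × V ↦ ¬ F.Reachable p.1 p.2),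
        ((Finset.univ.filter fun T : SimpleGraph V ↦
          T.IsTree ∧ F ⊔ edge p.1 p.2 ≤ T).card : ℝ) * Fintype.card V ^ 2 =
        Fintype.card V ^ (m + 1) * F.componentProd *
          (1 / (F.component p.1).card + 1 / (F.component p.2).card) := by
      rintro ⟨u, v⟩ hp
      have hp : ¬ F.Reachable u v := by simpa using hp
      have hne : u ≠ v := fun h ↦ hp (h ▸ .rfl)
      have hcard := F.ncard_edgeSet_sup_edge (fun h ↦ hp h.reachable) hne
      rw [ih (hF.sup_edge_of_not_reachable hp) (by omega)
        (by rw [componentSum_sup_edge hp, hk]; push_cast; ring), componentProd_sup_edge hp,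
        mul_assoc]
    have hsum' := congrArg (fun k : ℕ ↦ (k : ℝ) * (Fintype.card V : ℝ) ^ 2) hsum
    simp only [Nat.cast_sum, Finset.sum_mul] at hsum'
    rw [Finset.sum_congr rfl hstep, ← Finset.mul_sum, sum_not_reachable, hk] at hsum'
    push_cast at hsum'
    have hm0 : (2 * (m + 1) : ℝ) ≠ 0 := by positivity
    apply mul_left_cancel₀ hm0
    linear_combination -hsum'

theorem component_edge_of_notMem {a b x : V} (h : x ∉ s(a, b)) :
    (edge a b).component x = {x} := by
  rw [Sym2.mem_iff, not_or] at h
  rw [← bot_sup_eq (edge a b), component_sup_edge_of_notMem, component_bot] <;>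
    simp [Ne.symm h.1, Ne.symm h.2]

theorem card_component_edge_left {a b : V} (hab : a ≠ b) : ((edge a b).component a).card = 2 := by
  classical
  rw [← bot_sup_eq (edge a b), component_sup_edge_left, component_bot, component_bot,
    ← Finset.insert_eq, Finset.card_pair hab]

theorem card_component_edge_of_mem {a b x : V} (hab : a ≠ b) (h : x ∈ s(a, b)) :
    ((edge a b).component x).card = 2 := by
  rcases Sym2.mem_iff.mp h with rfl | rfl
  · exact card_component_edge_left hab
  · rw [edge_comm]
    exact card_component_edge_left hab.symm

open Classical in
theorem card_isTree_ge_edge_sup_edge {a b c d : V} (hab : a ≠ b)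
    (hcd : ¬ (edge a b).Reachable c d) :
    ({T : SimpleGraph V | T.IsTree ∧ edge a b ⊔ edge c d ≤ T}.ncard : ℝ) *
      Fintype.card V ^ 4 = Fintype.card V ^ Fintype.card V *
        (2 * (1 / ((edge a b).component c).card + 1 / ((edge a b).component d).card)) := by
  have hset : {T : SimpleGraph V | T.IsTree ∧ edge a b ⊔ edge c d ≤ T} =
      Finset.univ.filter fun T : SimpleGraph V ↦ T.IsTree ∧ edge a b ⊔ edge c d ≤ T := by
    simp
  rw [hset, Set.ncard_coe_finset]
  have hr : ¬ (⊥ : SimpleGraph V).Reachable a b := by simpa using hab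
  have hbot : (⊥ : SimpleGraph V) ⊔ edge a b = edge a b := bot_sup_eq _
  have h1 : (edge a b).edgeSet.ncard = 1 := by
    rw [edgeSet_edge_of_ne hab, Set.ncard_singleton]
  have h2 := ncard_edgeSet_sup_edge (edge a b) (fun h ↦ hcd h.reachable)
    (fun h : c = d ↦ hcd (h ▸ .rfl))
  have hac : (edge a b).IsAcyclic := hbot ▸ isAcyclic_bot.sup_edge_of_not_reachable hr
  have hp := componentProd_sup_edge hr
  have hs := componentSum_sup_edge hr (fun _ ↦ 1)
  have hs' := componentSum_sup_edge hcd (fun _ ↦ 1)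
  rw [componentSum_bot, hbot] at hs
  simp only [component_bot, componentProd_bot, Finset.card_singleton, hbot] at hp
  have hpos : 0 < (edge a b ⊔ edge c d).componentSum (fun _ ↦ 1) := by
    rw [componentSum]
    have : Nonempty V := ⟨a⟩
    refine Finset.sum_pos (fun u _ ↦ ?_) Finset.univ_nonempty
    have := (edge a b ⊔ edge c d).card_component_pos u
    positivity
  have hV : 2 < Fintype.card V := by
    rw [hs', hs] at hpos
    have : (2 : ℝ) < Fintype.card V := by linarith
    exact_mod_cast this
  obtain ⟨m, hm⟩ := Nat.exists_eq_add_of_lt hV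
  have key := (hac.sup_edge_of_not_reachable hcd).card_isTree_ge (m := m) (by omega)
    (by rw [hs', hs, hm]; push_cast; ring)
  rw [componentProd_sup_edge hcd, hp] at key
  have hm' : Fintype.card V = m + 1 + 2 := by omega
  conv_rhs => rw [show ((Fintype.card V : ℝ) ^ Fintype.card V) =
    Fintype.card V ^ (m + 1 + 2) by rw [← hm']]
  linear_combination (Fintype.card V : ℝ) ^ 2 * key

/-- The number of spanning trees of the complete graph containing two given distinct edges. -/
theorem ncard_isTree_of_mem_edgeSet [DecidableEq V] {e f : Sym2 V} (he : ¬ e.IsDiag)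
    (hf : ¬ f.IsDiag) (hef : e ≠ f) :
    ({T : SimpleGraph V | T.IsTree ∧ e ∈ T.edgeSet ∧ f ∈ T.edgeSet}.ncard : ℚ) =
      (Fintype.card V : ℚ) ^ ((Fintype.card V : ℤ) - 4) *
        (4 - (e.toFinset ∩ f.toFinset).card) := by
  classical
  obtain ⟨c, d, rfl, hd⟩ : ∃ c d, f = s(c, d) ∧ d ∉ e := by
    induction f with | h c d
    by_cases hd : d ∈ e
    · refine ⟨d, c, Sym2.eq_swap, fun hc ↦ hef ?_⟩
      exact ((Sym2.mem_and_mem_iff (by simpa using hf)).mp ⟨hc, hd⟩)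
    · exact ⟨c, d, rfl, hd⟩
  induction e with | h a b
  have hab : a ≠ b := by simpa using he
  have hcd : c ≠ d := by simpa using hf
  have hr : ¬ (edge a b).Reachable c d := fun h ↦ by
    have := mem_component.mpr h.symm
    rw [component_edge_of_notMem hd, Finset.mem_singleton] at this
    exact hcd this
  have key := card_isTree_ge_edge_sup_edge hab hr
  have hset : {T : SimpleGraph V | T.IsTree ∧ s(a, b) ∈ T.edgeSet ∧ s(c, d) ∈ T.edgeSet} =
      {T : SimpleGraph V | T.IsTree ∧ edge a b ⊔ edge c d ≤ T} := by
    ext T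
    simp [hab, hcd]
  have hinter : (2 * (1 / ((edge a b).component c).card + 1 / ((edge a b).component d).card) : ℝ) =
      4 - (s(a, b).toFinset ∩ s(c, d).toFinset).card := by
    rw [component_edge_of_notMem hd]
    by_cases hc : c ∈ s(a, b)
    · have : s(a, b).toFinset ∩ s(c, d).toFinset = {c} := by
        ext x
        simp only [Finset.mem_inter, Sym2.mem_toFinset, Finset.mem_singleton]
        grind
      rw [this, card_component_edge_of_mem hab hc]
      norm_num
    · have : s(a, b).toFinset ∩ s(c, d).toFinset = ∅ := by
        ext x
        simp only [Finset.mem_inter, Sym2.mem_toFinset, Finset.notMem_empty]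
        grind
      rw [this, component_edge_of_notMem hc]
      norm_num
  rw [hinter] at key
  have hV : (Fintype.card V : ℚ) ≠ 0 := by
    have : Nonempty V := ⟨a⟩
    exact_mod_cast Fintype.card_ne_zero
  rw [hset]
  generalize {T : SimpleGraph V | T.IsTree ∧ edge a b ⊔ edge c d ≤ T}.ncard = N at key ⊢
  generalize (s(a, b).toFinset ∩ s(c, d).toFinset).card = M at key ⊢
  generalize Fintype.card V = n at key hV ⊢
  rw [zpow_sub₀ hV, zpow_natCast, zpow_ofNat, div_mul_eq_mul_div,
    eq_div_iff (pow_ne_zero _ hV)]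
  exact_mod_cast key

end SimpleGraph

open Polynomial in
theorem Matrix.charpoly_smul_ones_add_scalar {ι R : Type*} [Fintype ι] [DecidableEq ι] [Nonempty ι]
    [CommRing R] (a b : R) :
    (a • Matrix.of (fun _ _ : ι ↦ (1 : R)) + Matrix.scalar ι b).charpoly =
      (X - C b) ^ (Fintype.card ι - 1) * (X - C (Fintype.card ι * a + b)) := by
  have h : a • Matrix.of (fun _ _ : ι ↦ (1 : R)) + Matrix.scalar ι b =
      Matrix.vecMulVec (fun _ ↦ a) (fun _ ↦ 1) - Matrix.scalar ι (-b) := by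
    rw [map_neg, sub_neg_eq_add]
    ext
    simp [Matrix.vecMulVec_apply]
  obtain ⟨k, hk⟩ := Nat.exists_eq_add_of_lt (Fintype.card_pos (α := ι))
  rw [h, Matrix.charpoly_sub_scalar, Matrix.charpoly_vecMulVec]
  simp only [dotProduct, mul_one, Finset.sum_const, Finset.card_univ, nsmul_eq_mul, hk,
    smul_eq_C_mul, zero_add, Nat.add_sub_cancel]
  simp
  ring

/-- The edges of the complete graph on `Fin n`. -/
abbrev Edge (n : ℕ) := {e : Sym2 (Fin n) // ¬ e.IsDiag}

/-- The vertex-edge incidence matrix of the complete graph. -/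
def completeIncMatrix (n : ℕ) : Matrix (Fin n) (Edge n) ℚ :=
  Matrix.of fun v e ↦ if v ∈ e.1 then 1 else 0

section Incidence

open Matrix

theorem completeIncMatrix_mul_transpose (n : ℕ) :
    completeIncMatrix n * (completeIncMatrix n)ᵀ =
      Matrix.of (fun _ _ ↦ 1) + Matrix.scalar (Fin n) ((n : ℚ) - 2) := by
  have h : completeIncMatrix n * (completeIncMatrix n)ᵀ =
      (⊤ : SimpleGraph (Fin n)).incMatrix ℚ * ((⊤ : SimpleGraph (Fin n)).incMatrix ℚ)ᵀ := by
    ext a b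
    simp only [Matrix.mul_apply, transpose_apply]
    rw [← Finset.sum_subset
        (Finset.subset_univ (Finset.univ.filter fun e : Sym2 (Fin n) ↦ ¬ e.IsDiag)),
      Finset.sum_subtype (p := fun e : Sym2 (Fin n) ↦ ¬ e.IsDiag) _ (by simp)]
    · refine Finset.sum_congr rfl fun e _ ↦ ?_
      simp [completeIncMatrix, SimpleGraph.incMatrix_apply', SimpleGraph.incidenceSet, e.2]
    · intro e _ he
      simp only [Finset.mem_filter, Finset.mem_univ, true_and, not_not] at he
      simp [SimpleGraph.incMatrix_apply', SimpleGraph.incidenceSet, he]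
  rw [h, SimpleGraph.incMatrix_mul_transpose]
  ext a b
  rcases eq_or_ne a b with rfl | hab
  · have : 1 ≤ n := by have := a.2; omega
    simp [this]
    ring
  · simp [hab]

theorem transpose_mul_ones_mul_completeIncMatrix (n : ℕ) :
    (completeIncMatrix n)ᵀ * Matrix.of (fun _ _ : Fin n ↦ (1 : ℚ)) * completeIncMatrix n =
      Matrix.of fun _ _ ↦ 4 := by
  have h : ∀ e : Edge n, ∑ v, (if v ∈ e.1 then 1 else 0 : ℚ) = 2 := fun e ↦ by
    rw [Finset.sum_boole, ← Nat.cast_two, ← Sym2.card_toFinset_of_not_isDiag _ e.2]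
    congr 2
    ext; simp
  ext e f
  simp only [Matrix.mul_apply, transpose_apply, completeIncMatrix, Matrix.of_apply, mul_one,
    h, ← Finset.mul_sum]
  norm_num

theorem transpose_mul_completeIncMatrix (n : ℕ) (e f : Edge n) :
    ((completeIncMatrix n)ᵀ * completeIncMatrix n) e f = (e.1.toFinset ∩ f.1.toFinset).card := by
  simp only [Matrix.mul_apply, transpose_apply, completeIncMatrix, Matrix.of_apply, ← ite_and,
    mul_ite, mul_one, mul_zero]
  rw [Finset.sum_boole]
  congr 2
  ext
  simp [and_comm]

open Polynomial in
/-- The spectrum of `4 (J - 1)` minus the adjacency matrix of the line graph of the complete graph,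
scaled by `c`. -/
theorem charpoly_of_card_inter (n : ℕ) (hn : 3 ≤ n) (c : ℚ)
    (H : Matrix (Edge n) (Edge n) ℚ)
    (hH : ∀ e f, H e f = if e = f then 0 else c * (4 - (e.1.toFinset ∩ f.1.toFinset).card)) :
    H.charpoly = (X - C (-2 * c)) ^ (Nat.choose n 2 - n) * (X - C (-(n * c))) ^ (n - 1) *
      (X - C (2 * (n - 2) * (n * c))) := by
  have : NeZero n := ⟨by omega⟩
  set B := completeIncMatrix n
  set J : Matrix (Fin n) (Fin n) ℚ := Matrix.of fun _ _ ↦ 1 with hJ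
  have hHB : H = Bᵀ * (c • (J - 1) * B) - Matrix.scalar _ (2 * c) := by
    have : Bᵀ * (c • (J - 1) * B) = c • (Bᵀ * J * B - Bᵀ * B) := by
      simp only [Matrix.smul_mul, Matrix.mul_smul, Matrix.sub_mul, Matrix.mul_sub, Matrix.one_mul,
        Matrix.mul_assoc]
    rw [this, transpose_mul_ones_mul_completeIncMatrix]
    ext e f
    rw [hH, Matrix.sub_apply, Matrix.smul_apply, Matrix.sub_apply,
      transpose_mul_completeIncMatrix]
    rcases eq_or_ne e f with rfl | h
    · simp [Sym2.card_toFinset_of_not_isDiag _ e.2]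
      ring
    · simp [h]
  have hJJ : J * J = (n : ℚ) • J := by
    ext i j
    simp [hJ, Matrix.mul_apply]
  have hV : c • (J - 1) * B * Bᵀ =
      (c * (2 * n - 3)) • J + Matrix.scalar (Fin n) (-(c * (n - 2))) := by
    rw [Matrix.mul_assoc, completeIncMatrix_mul_transpose, Matrix.scalar_apply,
      Matrix.scalar_apply, ← smul_one_eq_diagonal, ← smul_one_eq_diagonal, ← hJ, Matrix.smul_mul,
      Matrix.sub_mul, Matrix.mul_add, Matrix.mul_smul, hJJ, Matrix.mul_one, Matrix.one_mul]
    module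
  have hcard : Fintype.card (Edge n) = n.choose 2 := by
    rw [Sym2.card_subtype_not_diag, Fintype.card_fin]
  have hle : n ≤ n.choose 2 := by
    rw [Nat.choose_two_right, Nat.le_div_iff_mul_le two_pos]
    exact Nat.mul_le_mul_left n (by omega)
  rw [hHB, Matrix.charpoly_sub_scalar, Matrix.charpoly_mul_comm_of_le _ _ (by simpa [hcard]), hV,
    Matrix.charpoly_smul_ones_add_scalar, hcard, Fintype.card_fin]
  have hshift (b : ℚ) : X + C (2 * c) - C b = X - C (b - 2 * c) := by
    rw [C_sub]
    ring
  simp only [mul_comp, pow_comp, sub_comp, X_comp, C_comp, hshift]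
  rw [mul_assoc]
  congr 3
  · simp
  · congr 2
    ring
  · congr 1
    ring


end Incidence

/-- Eigenvalues (with multiplicities, encoded by the characteristic polynomial) of the
matrix `H̃` indexed by edges of `K_n` whose off-diagonal `(i,j)` entry is the number of
spanning trees of `K_n` containing both edges `i` and `j`, and whose diagonal is `0`:
they are `-2 n^(n-4)`, `-n^(n-3)`, `2(n-2) n^(n-3)` with multiplicities
`C(n,2) - n`, `n - 1`, `1`. -/
theorem stmt_7 (n : ℕ) (hn : 3 ≤ n) :
    let H : Matrix {e : Sym2 (Fin n) // ¬ e.IsDiag} {e : Sym2 (Fin n) // ¬ e.IsDiag} ℚ :=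
      Matrix.of fun e f => if e = f then 0 else
        ({T : SimpleGraph (Fin n) | T.IsTree ∧ e.1 ∈ T.edgeSet ∧ f.1 ∈ T.edgeSet}.ncard : ℚ)
    H.charpoly
      = (Polynomial.X - Polynomial.C (-2 * (n : ℚ) ^ ((n : ℤ) - 4))) ^ (Nat.choose n 2 - n) *
        (Polynomial.X - Polynomial.C (-(n : ℚ) ^ ((n : ℤ) - 3))) ^ (n - 1) *
        (Polynomial.X - Polynomial.C (2 * ((n : ℚ) - 2) * (n : ℚ) ^ ((n : ℤ) - 3))) := by
  intro H
  have hn0 : (n : ℚ) ≠ 0 := by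
    have : n ≠ 0 := by omega
    exact_mod_cast this
  have hpow : (n : ℚ) ^ ((n : ℤ) - 3) = n * (n : ℚ) ^ ((n : ℤ) - 4) := by
    rw [← zpow_one_add₀ hn0]
    congr 1
    ring
  rw [hpow]
  refine charpoly_of_card_inter n hn _ H fun e f ↦ ?_
  simp only [H, Matrix.of_apply]
  split_ifs with h
  · rfl
  · have := SimpleGraph.ncard_isTree_of_mem_edgeSet e.2 f.2 fun h' ↦ h (Subtype.ext h')
    rwa [Fintype.card_fin] at this
end

section
/- Let n ≥ 3 and let H̃ be the C(n,2)×C(n,2) symmetric matrix indexed by edges of K_n with (i,j) entry equal to the number of spanning trees containing edges i and j. Then det H̃ = (−1)^{C(n,2)−1} · 2^{C(n,2)−n+1} · n^{n + C(n,2)(n−4)} · (n−2). In particular det H̃ ≠ 0. -/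
/-- `f` is the parent map of a tree on `V` rooted at `r`. -/
def IsRootedAt {V : Type*} (f : V → V) (r : V) : Prop :=
  f r = r ∧ ∀ v, ∃ k, f^[k] v = r

/-- The undirected graph whose edges join each vertex to its image under `f`. -/
def parentGraph {V : Type*} (f : V → V) : SimpleGraph V :=
  SimpleGraph.fromRel fun v w => f v = w

lemma parentGraph_adj {V : Type*} {f : V → V} {v w : V} :
    (parentGraph f).Adj v w ↔ v ≠ w ∧ (f v = w ∨ f w = v) := by
  simp [parentGraph]

lemma IsRootedAt.eq_of_iterate_succ_eq {V : Type*} {f : V → V} {r v : V} (hf : IsRootedAt f r)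
    {j : ℕ} (hv : f^[j + 1] v = v) : v = r := by
  obtain ⟨m, hm⟩ := hf.2 v
  have h1 : f^[(j + 1) * m] v = v := by
    rw [Function.iterate_mul]
    exact Function.iterate_fixed hv m
  have h2 : (j + 1) * m = j * m + m := by ring
  rw [h2, Function.iterate_add_apply, hm, Function.iterate_fixed hf.1] at h1
  exact h1.symm

lemma iterate_eq_of_agree_off_fixed {V : Type*} {f g : V → V}
    (hfg : ∀ v, g v ≠ v → f v = g v) {ρ : V} (k : ℕ) :
    ∀ v, g^[k] v = ρ → ∃ j, f^[j] v = ρ := by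
  induction k with
  | zero => exact fun v hv => ⟨0, hv⟩
  | succ k ih =>
    intro v hv
    by_cases h : g v = v
    · exact ⟨0, by rw [Function.iterate_fixed h] at hv; exact hv⟩
    · rw [Function.iterate_succ_apply] at hv
      obtain ⟨j, hj⟩ := ih _ hv
      exact ⟨j + 1, by rw [Function.iterate_succ_apply, hfg v h, hj]⟩

/-- The number of rooted trees extending a rooted forest, times the number of vertices. Here `g` is
the parent map of the forest (fixing its roots) and `b` sends a vertex to the root of its
component. -/
lemma card_mul_card_rooted_extensions {V : Type*} [Fintype V] [DecidableEq V] (r : V) (c : ℕ) :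
    ∀ g b : V → V, (∀ v, g (b v) = b v ∧ ∃ k, g^[k] v = b v) → g r = r →
      {v | g v = v}.ncard = c + 1 →
      Fintype.card V * {f | IsRootedAt f r ∧ ∀ v, g v ≠ v → f v = g v}.ncard =
        {v | b v = r}.ncard * Fintype.card V ^ c := by
  induction c with
  | zero =>
    intro g b hb hr hc
    obtain ⟨a, ha⟩ := Set.ncard_eq_one.1 hc
    have hfix : ∀ v, g v = v ↔ v = r := by
      intro v
      have h1 : r = a := by simpa using ha.subset (show r ∈ {v | g v = v} from hr)
      have h2 : v ∈ {v | g v = v} ↔ v ∈ ({a} : Set V) := by rw [ha]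
      simpa [h1] using h2
    have hbr : ∀ v, b v = r := fun v => (hfix _).1 (hb v).1
    have h1 : {f | IsRootedAt f r ∧ ∀ v, g v ≠ v → f v = g v} = {g} := by
      ext f
      simp only [Set.mem_ofPred_eq, Set.mem_singleton_iff]
      constructor
      · rintro ⟨hf, hfg⟩
        ext v
        by_cases h : g v = v
        · obtain rfl := (hfix v).1 h
          rw [hf.1, h]
        · exact hfg v h
      · rintro rfl
        exact ⟨⟨hr, fun v => by simpa [hbr] using (hb v).2⟩, fun _ _ => rfl⟩
    have h2 : {v | b v = r} = Set.univ := by ext v; simp [hbr]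
    rw [h1, h2]
    simp [Set.ncard_univ]
  | succ c ih =>
    intro g b hb hr hc
    obtain ⟨ρ, hρ, hρr⟩ : ∃ ρ ∈ {v | g v = v}, ρ ≠ r :=
      Set.exists_ne_of_one_lt_ncard (by omega) r
    have hρ : g ρ = ρ := hρ
    have hbfix : ∀ v, g v = v → b v = v := by
      intro v hv
      obtain ⟨k, hk⟩ := (hb v).2
      rw [Function.iterate_fixed hv] at hk
      exact hk.symm
    have hbg : ∀ v, b (g v) = b v := by
      intro v
      obtain ⟨k, hk⟩ := (hb v).2
      obtain ⟨l, hl⟩ := (hb (g v)).2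
      have h1 : g^[l + 1 + k] v = b v := by
        rw [Function.iterate_add_apply, hk, Function.iterate_fixed (hb v).1]
      have h2 : g^[k + (l + 1)] v = b (g v) := by
        rw [Function.iterate_add_apply, Function.iterate_succ_apply, hl,
          Function.iterate_fixed (hb _).1]
      rw [← h1, ← h2, add_comm]
    have hfiber : ∀ y, {f | (IsRootedAt f r ∧ ∀ v, g v ≠ v → f v = g v) ∧ f ρ = y} =
        if b y = ρ then ∅ else {f | IsRootedAt f r ∧
          ∀ v, Function.update g ρ y v ≠ v → f v = Function.update g ρ y v} := by
      intro y
      split_ifs with hy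
      · rw [Set.eq_empty_iff_forall_notMem]
        rintro f ⟨⟨hf, hfg⟩, hfy⟩
        obtain ⟨k, hk⟩ := (hb y).2
        rw [hy] at hk
        obtain ⟨j, hj⟩ := iterate_eq_of_agree_off_fixed hfg k y hk
        exact hρr (hf.eq_of_iterate_succ_eq (j := j)
          (by rw [Function.iterate_succ_apply, hfy, hj]))
      · have hyρ : y ≠ ρ := fun h => hy (by rw [h, hbfix ρ hρ])
        ext f
        simp only [Set.mem_ofPred_eq]
        constructor
        · rintro ⟨⟨hf, hfg⟩, hfy⟩
          refine ⟨hf, fun v hv => ?_⟩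
          by_cases h : v = ρ
          · subst h; simpa using hfy
          · rw [Function.update_of_ne h] at hv ⊢
            exact hfg v hv
        · rintro ⟨hf, hfg⟩
          refine ⟨⟨hf, fun v hv => ?_⟩, ?_⟩
          · have h : v ≠ ρ := fun h => hv (by rw [h, hρ])
            have := hfg v
            rw [Function.update_of_ne h] at this
            exact this hv
          · have := hfg ρ
            rw [Function.update_self] at this
            exact this hyρ
    have hcount : ∀ y, b y ≠ ρ → Fintype.card V * {f | IsRootedAt f r ∧
          ∀ v, Function.update g ρ y v ≠ v → f v = Function.update g ρ y v}.ncard =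
        ({v | b v = r}.ncard + if b y = r then {v | b v = ρ}.ncard else 0) *
          Fintype.card V ^ c := by
      intro y hy
      have hyρ : y ≠ ρ := fun h => hy (by rw [h, hbfix ρ hρ])
      have hiter : ∀ k v, b v ≠ ρ → (Function.update g ρ y)^[k] v = g^[k] v := by
        intro k
        induction k with
        | zero => simp
        | succ k ihk =>
          intro v hv
          have h : v ≠ ρ := fun h => hv (by rw [h, hbfix ρ hρ])
          rw [Function.iterate_succ_apply, Function.iterate_succ_apply,
            Function.update_of_ne h, ihk _ (by rwa [hbg])]
      have hreach : ∀ k v, g^[k] v = ρ → ∃ j, (Function.update g ρ y)^[j] v = y := by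
        intro k
        induction k with
        | zero => exact fun v hv => ⟨1, by simp at hv; simp [hv]⟩
        | succ k ihk =>
          intro v hv
          by_cases h : v = ρ
          · exact ⟨1, by simp [h]⟩
          · obtain ⟨j, hj⟩ := ihk (g v) hv
            exact ⟨j + 1, by rw [Function.iterate_succ_apply, Function.update_of_ne h, hj]⟩
      rw [ih (Function.update g ρ y) (fun v => if b v = ρ then b y else b v)]
      · congr 1
        split_ifs with hyr
        · rw [← Set.ncard_union_eq]
          · congr 1
            ext v
            simp only [Set.mem_ofPred_eq, Set.mem_union]
            split_ifs with h <;> simp [h, hyr]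
          · rw [Set.disjoint_left]
            rintro v (h1 : b v = r) (h2 : b v = ρ)
            exact hρr (h2.symm.trans h1)
        · congr 1
          ext v
          simp only [Set.mem_ofPred_eq]
          split_ifs with h
          · simp [h, hyr, hρr]
          · rfl
      · intro v
        split_ifs with h
        · refine ⟨by rw [Function.update_of_ne hy]; exact (hb y).1, ?_⟩
          obtain ⟨k, hk⟩ := (hb v).2
          obtain ⟨j, hj⟩ := hreach k v (hk.trans h)
          obtain ⟨l, hl⟩ := (hb y).2
          exact ⟨l + j, by rw [Function.iterate_add_apply, hj, hiter l y hy, hl]⟩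
        · refine ⟨by rw [Function.update_of_ne h]; exact (hb v).1, ?_⟩
          obtain ⟨k, hk⟩ := (hb v).2
          exact ⟨k, by rw [hiter k v h, hk]⟩
      · rw [Function.update_of_ne hρr.symm, hr]
      · have h1 : {v | Function.update g ρ y v = v} = {v | g v = v} \ {ρ} := by
          ext v
          by_cases h : v = ρ
          · subst h; simp [hyρ]
          · simp [h]
        rw [h1, Set.ncard_sdiff_singleton_of_mem (show ρ ∈ {v | g v = v} from hρ), hc]
        rfl
    have hsum : {f | IsRootedAt f r ∧ ∀ v, g v ≠ v → f v = g v}.ncard =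
        ∑ y, {f | (IsRootedAt f r ∧ ∀ v, g v ≠ v → f v = g v) ∧ f ρ = y}.ncard := by
      classical
      simp only [Set.ncard_eq_toFinset_card', Set.toFinset_ofPred]
      rw [Finset.card_eq_sum_card_fiberwise (f := fun f => f ρ) (t := Finset.univ)
        (fun _ _ => Finset.mem_coe.2 (Finset.mem_univ _))]
      simp only [Finset.filter_filter]
    rw [hsum, Finset.mul_sum]
    have hterm : ∀ y, Fintype.card V *
        {f | (IsRootedAt f r ∧ ∀ v, g v ≠ v → f v = g v) ∧ f ρ = y}.ncard =
        ((if b y ≠ ρ then {v | b v = r}.ncard else 0) +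
          if b y = r then {v | b v = ρ}.ncard else 0) * Fintype.card V ^ c := by
      intro y
      rw [hfiber y]
      by_cases h : b y = ρ
      · simp [h, hρr]
      · rw [if_neg h, if_pos h, hcount y h]
    rw [Finset.sum_congr rfl fun y _ => hterm y, ← Finset.sum_mul, Finset.sum_add_distrib,
      ← Finset.sum_filter, ← Finset.sum_filter, Finset.sum_const, Finset.sum_const, smul_eq_mul,
      smul_eq_mul, pow_succ']
    simp only [Set.ncard_eq_toFinset_card', Set.toFinset_ofPred]
    rw [← mul_assoc, ← Finset.card_univ,
      ← Finset.card_filter_add_card_filter_not (s := Finset.univ) (fun y => b y = ρ)]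
    ring

/-- Number of rooted trees containing a rooted forest of height at most one. -/
lemma card_mul_card_rooted_extensions_of_idempotent {V : Type*} [Fintype V] [DecidableEq V]
    {r : V} {c : ℕ} {g : V → V} (hg : ∀ v, g (g v) = g v) (hr : g r = r)
    (hc : {v | g v = v}.ncard = c + 1) :
    Fintype.card V * {f | IsRootedAt f r ∧ ∀ v, g v ≠ v → f v = g v}.ncard =
      {v | g v = r}.ncard * Fintype.card V ^ c :=
  card_mul_card_rooted_extensions r c g g (fun v => ⟨hg v, 1, rfl⟩) hr hc

lemma IsRootedAt.connected_parentGraph {V : Type*} {f : V → V} {r : V} (hf : IsRootedAt f r) :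
    (parentGraph f).Connected := by
  have hreach : ∀ k v, f^[k] v = r → (parentGraph f).Reachable v r := by
    intro k
    induction k with
    | zero => rintro v rfl; exact .rfl
    | succ k ih =>
      intro v hv
      by_cases h : v = f v
      · rw [Function.iterate_fixed h.symm] at hv
        rw [hv]
      · exact (parentGraph_adj.2 ⟨h, .inl rfl⟩ : (parentGraph f).Adj v (f v)).reachable.trans
          (ih _ hv)
  have hr : ∀ v, (parentGraph f).Reachable v r := fun v => (hf.2 v).elim fun k => hreach k v
  exact (SimpleGraph.connected_iff_exists_forall_reachable _).2 ⟨r, fun v => (hr v).symm⟩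

lemma IsRootedAt.isTree_parentGraph {V : Type*} [Finite V] {f : V → V} {r : V}
    (hf : IsRootedAt f r) : (parentGraph f).IsTree := by
  have hconn := hf.connected_parentGraph
  refine SimpleGraph.isTree_iff_connected_and_card.2
    ⟨hconn, le_antisymm ?_ hconn.card_vert_le_card_edgeSet_add_one⟩
  have hsub : (parentGraph f).edgeSet ⊆ (fun v => s(v, f v)) '' (Set.univ \ {r}) := by
    intro e
    induction e using Sym2.ind with
    | _ v w =>
      rw [SimpleGraph.mem_edgeSet, parentGraph_adj]
      rintro ⟨hne, rfl | rfl⟩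
      · exact ⟨v, ⟨trivial, fun h => hne (by rw [h, hf.1])⟩, rfl⟩
      · exact ⟨w, ⟨trivial, fun h => hne (by rw [h, hf.1])⟩, Sym2.eq_swap⟩
  have h1 := (Set.ncard_le_ncard hsub).trans (Set.ncard_image_le (Set.toFinite _))
  have h2 := Set.ncard_sdiff_singleton_add_one (Set.mem_univ r)
  rw [Set.ncard_univ] at h2
  rw [Nat.card_coe_set_eq]
  omega

lemma IsRootedAt.eq_of_parentGraph_eq {V : Type*} {f f' : V → V} {r : V}
    (hf : IsRootedAt f r) (hf' : IsRootedAt f' r) (h : parentGraph f = parentGraph f') :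
    f = f' := by
  have key : ∀ k v, f^[k] v = r → f v = f' v := by
    intro k
    induction k with
    | zero => rintro v rfl; exact hf.1.trans hf'.1.symm
    | succ k ih =>
      intro v hv
      have hw := ih (f v) hv
      by_cases hvr : v = r
      · rw [hvr, hf.1, hf'.1]
      have hne : v ≠ f v := fun h0 => hvr (hf.eq_of_iterate_succ_eq (j := 0) h0.symm)
      have hadj : (parentGraph f').Adj v (f v) := h ▸ parentGraph_adj.2 ⟨hne, .inl rfl⟩
      rcases (parentGraph_adj.1 hadj).2 with h1 | h1
      · exact h1.symm
      · exact absurd (hf.eq_of_iterate_succ_eq (j := 1) (hw.trans h1)) hvr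
  ext v
  obtain ⟨k, hk⟩ := hf.2 v
  exact key k v hk

lemma SimpleGraph.IsTree.exists_parentGraph_eq {V : Type*} {T : SimpleGraph V} (hT : T.IsTree)
    (r : V) : ∃ f, IsRootedAt f r ∧ parentGraph f = T := by
  have hstep : ∀ v, ∃ w, (v = r → w = r) ∧ (v ≠ r → T.Adj v w ∧ T.dist w r + 1 = T.dist v r) := by
    intro v
    by_cases hv : v = r
    · exact ⟨r, fun _ => rfl, fun h => absurd hv h⟩
    obtain ⟨p, hp⟩ := hT.connected.exists_walk_length_eq_dist v r
    cases p with
    | nil => exact absurd rfl hv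
    | @cons _ w _ hadj q =>
      refine ⟨w, fun h => absurd h hv, fun _ => ⟨hadj, ?_⟩⟩
      have h1 := SimpleGraph.dist_le q
      have h2 := hT.connected.dist_triangle (u := v) (v := w) (w := r)
      rw [SimpleGraph.dist_eq_one_iff_adj.2 hadj] at h2
      rw [SimpleGraph.Walk.length_cons] at hp
      omega
  choose f hfr hf using hstep
  have hroot : IsRootedAt f r := by
    refine ⟨hfr r rfl, fun v => ?_⟩
    induction hd : T.dist v r generalizing v with
    | zero => exact ⟨0, hT.connected.dist_eq_zero_iff.1 hd⟩
    | succ d ih =>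
      have hv : v ≠ r := by rintro rfl; simp at hd
      obtain ⟨k, hk⟩ := ih (f v) (by have := (hf v hv).2; omega)
      exact ⟨k + 1, hk⟩
  refine ⟨f, hroot, ?_⟩
  have hle : parentGraph f ≤ T := by
    intro v w hvw
    obtain ⟨hne, h | h⟩ := parentGraph_adj.1 hvw
    · have hv : v ≠ r := fun hv => hne (by rw [← h, hfr v hv, hv])
      exact h ▸ (hf v hv).1
    · have hw : w ≠ r := fun hw => hne (by rw [← h, hfr w hw, hw])
      exact (h ▸ (hf w hw).1).symm
  exact le_antisymm hle
    ((SimpleGraph.isTree_iff_minimal_connected.1 hT).2 hroot.connected_parentGraph hle)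

lemma ncard_isTree_eq_ncard_isRootedAt {V : Type*} [Finite V] (r : V)
    (P : SimpleGraph V → Prop) :
    {T | T.IsTree ∧ P T}.ncard = {f | IsRootedAt f r ∧ P (parentGraph f)}.ncard := by
  rw [← Set.InjOn.ncard_image (f := parentGraph)
    fun f hf f' hf' h => hf.1.eq_of_parentGraph_eq hf'.1 h]
  congr 1
  ext T
  constructor
  · rintro ⟨hT, hP⟩
    obtain ⟨f, hf, rfl⟩ := hT.exists_parentGraph_eq r
    exact ⟨f, ⟨hf, hP⟩, rfl⟩
  · rintro ⟨f, ⟨hf, hP⟩, rfl⟩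
    exact ⟨hf.isTree_parentGraph, hP⟩

/-- Rooted trees in which two prescribed vertices `y` and `w` have prescribed parents. -/
lemma card_mul_card_rooted_two_arcs {V : Type*} [Fintype V] [DecidableEq V] {x y z w : V}
    (hxy : x ≠ y) (hzw : z ≠ w) (hyw : y ≠ w) (hzy : z ≠ y) (hxw : x ≠ w)
    (hn : 3 ≤ Fintype.card V) :
    Fintype.card V * {f | IsRootedAt f x ∧ f y = x ∧ f w = z}.ncard =
      (if x = z then 3 else 2) * Fintype.card V ^ (Fintype.card V - 3) := by
  set g : V → V := fun v => if v = y then x else if v = w then z else v with hgdef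
  have hgy : g y = x := by simp [hgdef]
  have hgw : g w = z := by simp [hgdef, hyw.symm]
  have hgne : ∀ v, v ≠ y → v ≠ w → g v = v := fun v h1 h2 => by simp [hgdef, h1, h2]
  have hext : {f | IsRootedAt f x ∧ f y = x ∧ f w = z} =
      {f | IsRootedAt f x ∧ ∀ v, g v ≠ v → f v = g v} := by
    ext f
    refine and_congr_right fun _ => ⟨fun h v hv => ?_, fun h => ⟨?_, ?_⟩⟩
    · by_cases h1 : v = y
      · rw [h1, hgy, h.1]
      by_cases h2 : v = w
      · rw [h2, hgw, h.2]
      exact absurd (hgne v h1 h2) hv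
    · rw [h y (by rwa [hgy]), hgy]
    · rw [h w (by rwa [hgw]), hgw]
  have hfix : {v | g v = v} = ((({y, w} : Finset V)ᶜ : Finset V) : Set V) := by
    ext v
    by_cases h1 : v = y
    · subst h1; simp [hgy, hxy]
    by_cases h2 : v = w
    · subst h2; simp [hgw, hzw]
    simp [hgne v h1 h2, h1, h2]
  rw [hext, card_mul_card_rooted_extensions_of_idempotent (c := Fintype.card V - 3)]
  · congr 1
    split_ifs with hxz
    · subst hxz
      have : {v | g v = x} = (({x, y, w} : Finset V) : Set V) := by
        ext v
        by_cases h1 : v = y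
        · subst h1; simp [hgy]
        by_cases h2 : v = w
        · subst h2; simp [hgw]
        simp [hgne v h1 h2, h1, h2]
      rw [this, Set.ncard_coe_finset, Finset.card_eq_three.2 ⟨x, y, w, hxy, hzw, hyw, rfl⟩]
    · have : {v | g v = x} = (({x, y} : Finset V) : Set V) := by
        ext v
        by_cases h1 : v = y
        · subst h1; simp [hgy]
        by_cases h2 : v = w
        · subst h2; simp [hgw, h1, Ne.symm hxz, hxw.symm]
        simp [hgne v h1 h2, h1]
      rw [this, Set.ncard_coe_finset, Finset.card_pair hxy]
  · intro v
    by_cases h1 : v = y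
    · rw [h1, hgy, hgne x hxy hxw]
    by_cases h2 : v = w
    · rw [h2, hgw, hgne z hzy hzw]
    rw [hgne v h1 h2, hgne v h1 h2]
  · exact hgne x hxy hxw
  · rw [hfix, Set.ncard_coe_finset, Finset.card_compl, Finset.card_pair hyw]
    omega

lemma IsRootedAt.root_adj_parentGraph {V : Type*} {f : V → V} {x y : V} (hf : IsRootedAt f x)
    (hxy : x ≠ y) : (parentGraph f).Adj x y ↔ f y = x := by
  rw [parentGraph_adj, hf.1]
  tauto

/-- Number of spanning trees of the complete graph containing two given adjacent edges. -/
lemma card_mul_card_isTree_two_adjacent_edges {V : Type*} [Fintype V] [DecidableEq V] {x y w : V}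
    (hxy : x ≠ y) (hxw : x ≠ w) (hyw : y ≠ w) (hn : 3 ≤ Fintype.card V) :
    Fintype.card V * {T : SimpleGraph V | T.IsTree ∧ T.Adj x y ∧ T.Adj x w}.ncard =
      3 * Fintype.card V ^ (Fintype.card V - 3) := by
  rw [ncard_isTree_eq_ncard_isRootedAt x fun T => T.Adj x y ∧ T.Adj x w]
  have h := card_mul_card_rooted_two_arcs (z := x) hxy hxw hyw hxy hxw hn
  rw [if_pos rfl] at h
  rw [← h]
  congr 2
  ext f
  exact and_congr_right fun hf => by
    rw [hf.root_adj_parentGraph hxy, hf.root_adj_parentGraph hxw]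

/-- Number of spanning trees of the complete graph containing two given disjoint edges. -/
lemma card_mul_card_isTree_two_disjoint_edges {V : Type*} [Fintype V] [DecidableEq V]
    {x y z w : V} (hxy : x ≠ y) (hzw : z ≠ w) (hxz : x ≠ z) (hxw : x ≠ w) (hyz : y ≠ z)
    (hyw : y ≠ w) (hn : 3 ≤ Fintype.card V) :
    Fintype.card V * {T : SimpleGraph V | T.IsTree ∧ T.Adj x y ∧ T.Adj z w}.ncard =
      4 * Fintype.card V ^ (Fintype.card V - 3) := by
  rw [ncard_isTree_eq_ncard_isRootedAt x fun T => T.Adj x y ∧ T.Adj z w]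
  have h1 := card_mul_card_rooted_two_arcs hxy hzw hyw hyz.symm hxw hn
  have h2 := card_mul_card_rooted_two_arcs hxy hzw.symm hyz hyw.symm hxz hn
  rw [if_neg hxz] at h1
  rw [if_neg hxw] at h2
  have hunion : {f | IsRootedAt f x ∧ (parentGraph f).Adj x y ∧ (parentGraph f).Adj z w} =
      {f | IsRootedAt f x ∧ f y = x ∧ f w = z} ∪ {f | IsRootedAt f x ∧ f y = x ∧ f z = w} := by
    ext f
    simp only [Set.mem_union, Set.mem_ofPred_eq, ← and_or_left]
    refine and_congr_right fun hf => ?_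
    rw [hf.root_adj_parentGraph hxy, parentGraph_adj]
    tauto
  rw [hunion, Set.ncard_union_eq, mul_add, h1, h2]
  · ring
  · rw [Set.disjoint_left]
    rintro f ⟨hf, -, hfw⟩ ⟨-, -, hfz⟩
    exact hxz (hf.eq_of_iterate_succ_eq (j := 1) (show f (f z) = z by rw [hfz, hfw])).symm

open Matrix in
/-- Determinant of the matrix `a • 1 - b • J`, where `J` is the all-ones matrix. -/
lemma det_smul_one_sub_smul_ones {V : Type*} [Fintype V] [DecidableEq V] {a : ℚ} (ha : a ≠ 0)
    (b : ℚ) :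
    (a • (1 : Matrix V V ℚ) - b • (Matrix.of fun _ _ => 1 : Matrix V V ℚ)).det =
      a ^ Fintype.card V * (1 - Fintype.card V * (b / a)) := by
  have h : a • (1 : Matrix V V ℚ) - b • (Matrix.of fun _ _ => 1 : Matrix V V ℚ) =
      a • (1 + replicateCol Unit (fun _ : V => -(b / a)) *
        replicateRow Unit fun _ : V => (1 : ℚ)) := by
    ext i j
    simp only [Matrix.sub_apply, Matrix.smul_apply, Matrix.add_apply, Matrix.of_apply,
      Matrix.mul_apply, Matrix.replicateCol_apply, Matrix.replicateRow_apply, Finset.univ_unique,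
      Finset.sum_singleton, smul_eq_mul]
    field_simp
    ring
  rw [h, det_smul, det_one_add_replicateCol_mul_replicateRow]
  simp only [dotProduct, one_mul, Finset.sum_const, Finset.card_univ, nsmul_eq_mul]
  ring

/-- The vertex-edge incidence matrix of the complete graph. -/
def completeIncidence (V : Type*) [DecidableEq V] : Matrix V {e : Sym2 V // ¬ e.IsDiag} ℚ :=
  Matrix.of fun v e => if v ∈ e.1 then 1 else 0

open Matrix in
/-- The matrix `Nᵀ (J - 1) N - 2`, where `N` is the incidence matrix of the complete graph and `J`
the all-ones matrix. -/
def edgeMatrix (V : Type*) [Fintype V] [DecidableEq V] :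
    Matrix {e : Sym2 V // ¬ e.IsDiag} {e : Sym2 V // ¬ e.IsDiag} ℚ :=
  (completeIncidence V)ᵀ * ((Matrix.of fun _ _ => 1 : Matrix V V ℚ) - 1) * completeIncidence V
    - (2 : ℚ) • 1

lemma sum_mem_sym2 {V : Type*} [Fintype V] [DecidableEq V] {x y : V} (hxy : x ≠ y) (F : V → ℚ) :
    ∑ v, (if v ∈ s(x, y) then F v else 0) = F x + F y := by
  rw [← Finset.sum_filter, ← Finset.sum_pair hxy]
  congr 1
  ext v
  simp

open Matrix in
lemma completeIncidence_mul_transpose {V : Type*} [Fintype V] [DecidableEq V] :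
    completeIncidence V * (completeIncidence V)ᵀ =
      ((Fintype.card V : ℚ) - 2) • (1 : Matrix V V ℚ) +
        (Matrix.of fun _ _ => 1 : Matrix V V ℚ) := by
  have hinc : ∀ (e : {e : Sym2 V // ¬ e.IsDiag}) (v : V),
      completeIncidence V v e = (⊤ : SimpleGraph V).incMatrix ℚ v e.1 := by
    intro e v
    simp only [completeIncidence, Matrix.of_apply, SimpleGraph.incMatrix_apply']
    congr 1
    simp [SimpleGraph.incidenceSet, e.2]
  have hsum : completeIncidence V * (completeIncidence V)ᵀ =
      (⊤ : SimpleGraph V).incMatrix ℚ * ((⊤ : SimpleGraph V).incMatrix ℚ)ᵀ := by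
    ext u v
    simp only [Matrix.mul_apply, Matrix.transpose_apply, hinc]
    rw [← Finset.sum_subtype (Finset.univ.filter fun e : Sym2 V => ¬ e.IsDiag) (by simp)
      fun e => (⊤ : SimpleGraph V).incMatrix ℚ u e * (⊤ : SimpleGraph V).incMatrix ℚ v e]
    refine Finset.sum_filter_of_ne fun e _ he hd => he ?_
    rw [SimpleGraph.incMatrix_apply', if_neg, zero_mul]
    simp [SimpleGraph.incidenceSet, hd]
  rw [hsum, SimpleGraph.incMatrix_mul_transpose]
  ext u v
  have hV : 1 ≤ Fintype.card V := Fintype.card_pos_iff.2 ⟨u⟩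
  by_cases h : u = v
  · subst h
    simp [Nat.cast_sub hV]
    ring
  · simp [h]

open Matrix in
lemma det_edgeMatrix {V : Type*} [Fintype V] [DecidableEq V] (hV : 3 ≤ Fintype.card V) :
    (edgeMatrix V).det =
      -(-2) ^ (Fintype.card V).choose 2 * (Fintype.card V / 2 : ℚ) ^ Fintype.card V *
        (2 * (Fintype.card V - 2)) := by
  have h0 : (Fintype.card V : ℚ) ≠ 0 := by positivity
  set N := completeIncidence V with hN
  set M : Matrix V V ℚ := Matrix.of (fun _ _ => 1) - 1 with hM
  have h1 : edgeMatrix V = (-2 : ℚ) • (1 - Nᵀ * (((1 / 2 : ℚ) • M) * N)) := by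
    rw [smul_sub, Matrix.smul_mul, Matrix.mul_smul, smul_smul, ← Matrix.mul_assoc, edgeMatrix,
      ← hM, ← hN]
    norm_num
    abel
  have h2 : 1 - ((1 / 2 : ℚ) • M * N) * Nᵀ = ((Fintype.card V : ℚ) / 2) • (1 : Matrix V V ℚ) -
      ((2 * (Fintype.card V : ℚ) - 3) / 2) • (Matrix.of fun _ _ => 1 : Matrix V V ℚ) := by
    rw [Matrix.mul_assoc, completeIncidence_mul_transpose]
    ext i j
    simp only [hM, Matrix.sub_apply, Matrix.smul_mul, Matrix.sub_mul, Matrix.mul_add,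
      Matrix.mul_smul, Matrix.one_mul, Matrix.add_apply, Matrix.smul_apply,
      Matrix.of_apply, Matrix.mul_apply, smul_eq_mul, Finset.sum_const, Finset.card_univ,
      nsmul_eq_mul, mul_one]
    ring
  rw [h1, det_smul, det_one_sub_mul_comm, h2, det_smul_one_sub_smul_ones (by positivity),
    Sym2.card_subtype_not_diag]
  field_simp
  ring

lemma edgeMatrix_apply {V : Type*} [Fintype V] [DecidableEq V]
    (e f : {e : Sym2 V // ¬ e.IsDiag}) :
    edgeMatrix V e f = 4 - (∑ v, if v ∈ e.1 then (if v ∈ f.1 then 1 else 0) else 0)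
      - if e = f then 2 else 0 := by
  have hdeg : ∀ e : {e : Sym2 V // ¬ e.IsDiag}, ∑ v, (if v ∈ e.1 then (1 : ℚ) else 0) = 2 := by
    rintro ⟨e, he⟩
    induction e using Sym2.ind with
    | _ x y =>
      rw [sum_mem_sym2 (by simpa using he) fun _ => 1]
      norm_num
  simp only [edgeMatrix, Matrix.mul_sub, Matrix.sub_mul, Matrix.mul_one, Matrix.sub_apply,
    Matrix.smul_apply, Matrix.one_apply, Matrix.mul_apply, Matrix.transpose_apply,
    completeIncidence, Matrix.of_apply, hdeg, mul_one, smul_eq_mul, ← Finset.mul_sum]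
  simp only [mul_ite, mul_one, mul_zero]
  norm_num
  exact Finset.sum_congr rfl fun v _ => by split_ifs <;> rfl

lemma ncard_isTree_two_edges {n : ℕ} (hn : 3 ≤ n) {e f : Sym2 (Fin n)} (he : ¬ e.IsDiag)
    (hf : ¬ f.IsDiag) (hef : e ≠ f) :
    ({T : SimpleGraph (Fin n) | T.IsTree ∧ e ∈ T.edgeSet ∧ f ∈ T.edgeSet}.ncard : ℚ) =
      (n : ℚ) ^ ((n : ℤ) - 4) *
        (4 - ∑ v, if v ∈ e then (if v ∈ f then 1 else 0) else 0) := by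
  have hn0 : (n : ℚ) ≠ 0 := by positivity
  have hpow : (n : ℚ) * (n : ℚ) ^ ((n : ℤ) - 4) = (n : ℚ) ^ (n - 3) := by
    rw [← zpow_one_add₀ hn0, ← zpow_natCast]
    congr 1
    omega
  apply mul_left_cancel₀ hn0
  rw [← mul_assoc, hpow]
  have hcard : 3 ≤ Fintype.card (Fin n) := by simpa using hn
  by_cases hmeet : ∃ x, x ∈ e ∧ x ∈ f
  · obtain ⟨x, ⟨y, rfl⟩, ⟨w, rfl⟩⟩ := hmeet
    have hxy : x ≠ y := by simpa using he
    have hxw : x ≠ w := by simpa using hf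
    have hyw : y ≠ w := by rintro rfl; exact hef rfl
    have h := card_mul_card_isTree_two_adjacent_edges hxy hxw hyw hcard
    rw [Fintype.card_fin] at h
    simp only [SimpleGraph.mem_edgeSet]
    rw [sum_mem_sym2 hxy fun v => if v ∈ s(x, w) then 1 else 0]
    simp only [Sym2.mem_iff, hxy.symm, hyw, true_or, or_self, if_true, if_false]
    have h3 : (4 : ℚ) - (1 + 0) = 3 := by norm_num
    rw [h3, mul_comm _ (3 : ℚ)]
    exact_mod_cast h
  · induction e using Sym2.ind with
    | _ x y =>
    induction f using Sym2.ind with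
    | _ z w =>
      have hxy : x ≠ y := by simpa using he
      have hzw : z ≠ w := by simpa using hf
      have hdisj : ∀ v, v ∈ s(x, y) → v ∉ s(z, w) := fun v h1 h2 => hmeet ⟨v, h1, h2⟩
      have hx := hdisj x (Sym2.mem_mk_left x y)
      have hy := hdisj y (Sym2.mem_mk_right x y)
      rw [sum_mem_sym2 hxy fun v => if v ∈ s(z, w) then 1 else 0, if_neg hx, if_neg hy]
      simp only [Sym2.mem_iff, not_or] at hx hy
      have h := card_mul_card_isTree_two_disjoint_edges hxy hzw hx.1 hx.2 hy.1 hy.2 hcard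
      rw [Fintype.card_fin] at h
      simp only [SimpleGraph.mem_edgeSet]
      rw [add_zero, sub_zero, mul_comm _ (4 : ℚ)]
      exact_mod_cast h


/-- Determinant of the matrix `H̃` indexed by edges of `K_n` whose off-diagonal `(i,j)`
entry is the number of spanning trees of `K_n` containing both edges `i, j` (diagonal
`0`): `det H̃ = (-1)^(C(n,2)-1) 2^(C(n,2)-n+1) n^(n + C(n,2)(n-4)) (n-2) ≠ 0`. -/
theorem stmt_8 (n : ℕ) (hn : 3 ≤ n) :
    let H : Matrix {e : Sym2 (Fin n) // ¬ e.IsDiag} {e : Sym2 (Fin n) // ¬ e.IsDiag} ℚ :=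
      Matrix.of fun e f => if e = f then 0 else
        ({T : SimpleGraph (Fin n) | T.IsTree ∧ e.1 ∈ T.edgeSet ∧ f.1 ∈ T.edgeSet}.ncard : ℚ)
    H.det = (-1 : ℚ) ^ (Nat.choose n 2 - 1) * 2 ^ (Nat.choose n 2 - n + 1) *
        (n : ℚ) ^ ((n : ℤ) + (Nat.choose n 2 : ℤ) * ((n : ℤ) - 4)) * ((n : ℚ) - 2) ∧
    H.det ≠ 0 := by
  intro H
  have hn0 : (n : ℚ) ≠ 0 := by positivity
  have hH : H = (n : ℚ) ^ ((n : ℤ) - 4) • edgeMatrix (Fin n) := by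
    ext e f
    rw [Matrix.smul_apply, edgeMatrix_apply, smul_eq_mul]
    by_cases hef : e = f
    · subst hef
      obtain ⟨e, he⟩ := e
      induction e using Sym2.ind with
      | _ x y =>
        rw [sum_mem_sym2 (by simpa using he) fun v => if v ∈ s(x, y) then 1 else 0]
        simp [H]
        norm_num
    · simp only [H, Matrix.of_apply, if_neg hef, sub_zero]
      exact ncard_isTree_two_edges hn e.2 f.2 fun h => hef (Subtype.ext h)
  have hchoose : n ≤ n.choose 2 := by
    rw [Nat.choose_two_right, Nat.le_div_iff_mul_le two_pos]
    exact Nat.mul_le_mul_left n (by omega)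
  obtain ⟨d, hd⟩ := Nat.exists_eq_add_of_le hchoose
  have hdet : H.det = (-1 : ℚ) ^ (Nat.choose n 2 - 1) * 2 ^ (Nat.choose n 2 - n + 1) *
      (n : ℚ) ^ ((n : ℤ) + (Nat.choose n 2 : ℤ) * ((n : ℤ) - 4)) * ((n : ℚ) - 2) := by
    rw [hH, Matrix.det_smul, Sym2.card_subtype_not_diag, det_edgeMatrix (by simpa using hn),
      Fintype.card_fin, zpow_add₀ hn0, zpow_natCast, mul_comm (Nat.choose n 2 : ℤ), zpow_mul,
      zpow_natCast, neg_pow (2 : ℚ), div_pow]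
    have h1 : (-1 : ℚ) ^ n.choose 2 = -(-1) ^ (n.choose 2 - 1) := by
      conv_lhs => rw [← Nat.sub_add_cancel (show 1 ≤ n.choose 2 by omega), pow_succ]
      ring
    have h2 : (2 : ℚ) ^ n.choose 2 = 2 ^ (n.choose 2 - n) * 2 ^ n := by
      rw [← pow_add, Nat.sub_add_cancel hchoose]
    rw [h1, h2, pow_succ]
    field_simp
  refine ⟨hdet, ?_⟩
  have hn2 : (n : ℚ) - 2 ≠ 0 := by
    have : (3 : ℚ) ≤ n := by exact_mod_cast hn
    linarith
  rw [hdet]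
  exact mul_ne_zero (mul_ne_zero (by positivity) (zpow_ne_zero _ hn0)) hn2
end
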